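/- Recursive language characterization (mutual nesting): let a, f, g be three distinct activities in 𝔸. Then L(▽_f(▽_g(×(a, △_f)))) consists exactly of the single-event traces ⟨e⟩ where, for some n ≥ 1, the event e is the sequence obtained by concatenating n copies of ⟨f, g⟩ followed by a (i.e., e = f, g, f, g, …, f, g, a with n occurrences of the pair f, g). -/

import Mathlib

/-- Symbols: activities `a ∈ 𝔸` and recursion markers `△_f`. -/
inductive HSym (A : Type*) where
  | act : A → HSym A
  | mark : A → HSym A

/-- An event is a finite sequence of symbols. -/
abbrev Event (A : Type*) := List (HSym A)

/-- A hierarchical trace is a finite sequence of events. -/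
abbrev HTrace (A : Type*) := List (Event A)

/-- Hierarchy concatenation `s.t`: prefix the symbol `s` to every event of the trace `t`
(for the empty trace it yields the single event `⟨s⟩`). -/
def hcat {A : Type*} (s : HSym A) : HTrace A → HTrace A
  | [] => [[s]]
  | t => t.map (s :: ·)

/-- Interleaving (shuffle) of two sequences. -/
inductive Interleaving {α : Type*} : List α → List α → List α → Prop
  | nil : Interleaving [] [] []
  | left {a t₁ t₂ t} : Interleaving t₁ t₂ t → Interleaving (a :: t₁) t₂ (a :: t)
  | right {a t₁ t₂ t} : Interleaving t₁ t₂ t → Interleaving t₁ (a :: t₂) (a :: t)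

/-- Sequence join. -/
def seqJoin {α : Type*} : List (Set (List α)) → Set (List α)
  | [] => {[]}
  | L :: Ls => {t | ∃ t₁ ∈ L, ∃ t₂ ∈ seqJoin Ls, t = t₁ ++ t₂}

/-- Exclusive-choice join. -/
def choiceJoin {α : Type*} (Ls : List (Set (List α))) : Set (List α) :=
  {t | ∃ L ∈ Ls, t ∈ L}

/-- Members of the loop language. -/
inductive LoopMem {α : Type*} (body redo : Set (List α)) : List α → Prop
  | single {t} : t ∈ body → LoopMem body redo t
  | cons {t t' r} : t ∈ body → t' ∈ redo → LoopMem body redo r →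
      LoopMem body redo (t ++ t' ++ r)

/-- Structured-loop join. -/
def loopJoin {α : Type*} : List (Set (List α)) → Set (List α)
  | [] => ∅
  | L :: Ls => {t | LoopMem L (choiceJoin Ls) t}

/-- Parallel join. -/
def parJoin {α : Type*} : List (Set (List α)) → Set (List α)
  | [] => {[]}
  | L :: Ls => {t | ∃ t₁ ∈ L, ∃ t₂ ∈ parJoin Ls, Interleaving t₁ t₂ t}

/-- Hierarchical process trees: process trees extended with the named-subtree
operator `▽_f` and the recursion leaf `△_f`. -/
inductive HTree (A : Type*) where
  | act : A → HTree A
  | tau : HTree A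
  | seq : List (HTree A) → HTree A
  | choice : List (HTree A) → HTree A
  | loop : List (HTree A) → HTree A
  | par : List (HTree A) → HTree A
  | named : A → HTree A → HTree A
  | recCall : A → HTree A

universe u

mutual
/-- `▽ˡ_f(M)`: the least hierarchical language satisfying
`▽ˡ_f(M) = { f.(t′₁ ⋯ t′ₙ) | ⟨x₁,…,xₙ⟩ ∈ M, t′ᵢ ∈ ψ_f(xᵢ) }`. -/
inductive NamedLang {A : Type u} (f : A) (M : Set (HTrace A)) : HTrace A → Prop
  | mk (xs : HTrace A) (ts : List (HTrace A)) :
      xs ∈ M → ts.length = xs.length →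
      (∀ i, Psi f M (xs.getD i []) (ts.getD i [])) →
      NamedLang f M (hcat (HSym.act f) ts.flatten)

/-- `ψ_f`: maps an event to the set of traces resolving the recursion markers `△_f`. -/
inductive Psi {A : Type u} (f : A) (M : Set (HTrace A)) : Event A → HTrace A → Prop
  | nil : Psi f M [] []
  | recSame {t : HTrace A} : NamedLang f M t → Psi f M [HSym.mark f] t
  | recOther {g : A} : g ≠ f → Psi f M [HSym.mark g] [[HSym.mark g]]
  | act {a : A} {x : Event A} {t : HTrace A} :
      Psi f M x t → Psi f M (HSym.act a :: x) (hcat (HSym.act a) t)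
end

/-- The hierarchical language of a hierarchical process tree. -/
def hlang {A : Type*} : HTree A → Set (HTrace A)
  | .act a => {[[HSym.act a]]}
  | .tau => {[]}
  | .recCall f => {[[HSym.mark f]]}
  | .seq Ps => seqJoin (Ps.attach.map fun p => hlang p.1)
  | .choice Ps => choiceJoin (Ps.attach.map fun p => hlang p.1)
  | .loop Ps => loopJoin (Ps.attach.map fun p => hlang p.1)
  | .par Ps => parJoin (Ps.attach.map fun p => hlang p.1)
  | .named f P => {t | NamedLang f (hlang P) t}
termination_by P => sizeOf P
decreasing_by
  all_goals first
    | (have := List.sizeOf_lt_of_mem p.2; simp; omega)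
    | simp

/-- Plain process trees: no named subtrees `▽` and no recursion leaves `△`. -/
inductive IsPlain {A : Type*} : HTree A → Prop
  | act (a : A) : IsPlain (HTree.act a)
  | tau : IsPlain HTree.tau
  | seq {Ps : List (HTree A)} : (∀ P ∈ Ps, IsPlain P) → IsPlain (HTree.seq Ps)
  | choice {Ps : List (HTree A)} : (∀ P ∈ Ps, IsPlain P) → IsPlain (HTree.choice Ps)
  | loop {Ps : List (HTree A)} : (∀ P ∈ Ps, IsPlain P) → IsPlain (HTree.loop Ps)
  | par {Ps : List (HTree A)} : (∀ P ∈ Ps, IsPlain P) → IsPlain (HTree.par Ps)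


theorem psi_nil_iff {A : Type*} {f : A} {M : Set (HTrace A)} {t : HTrace A} :
    Psi f M [] t ↔ t = [] :=
  ⟨fun h => by cases h; rfl, fun h => h ▸ Psi.nil⟩

theorem psi_act_cons_iff {A : Type*} {f b : A} {M : Set (HTrace A)} {x : Event A}
    {t : HTrace A} :
    Psi f M (HSym.act b :: x) t ↔ ∃ t', Psi f M x t' ∧ t = hcat (HSym.act b) t' :=
  ⟨fun h => by cases h with | act h => exact ⟨_, h, rfl⟩,
    fun ⟨_, h, ht⟩ => ht ▸ Psi.act h⟩

theorem psi_mark_of_ne_iff {A : Type*} {f g : A} (hgf : g ≠ f) {M : Set (HTrace A)}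
    {t : HTrace A} : Psi f M [HSym.mark g] t ↔ t = [[HSym.mark g]] :=
  ⟨fun h => by
    cases h with
    | recSame => exact absurd rfl hgf
    | recOther => rfl, fun h => h ▸ Psi.recOther hgf⟩

/-- A one-event trace of `M`, with its marker resolved, yields a trace of `▽ˡ_f(M)`. -/
theorem NamedLang.of_singleton {A : Type*} {f : A} {M : Set (HTrace A)} {x : Event A}
    {t : HTrace A} (hx : [x] ∈ M) (h : Psi f M x t) :
    NamedLang f M (hcat (HSym.act f) t) := by
  have := NamedLang.mk (f := f) [x] [t] hx rfl fun i => by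
    cases i with
    | zero => exact h
    | succ i => exact Psi.nil
  simpa using this

theorem namedLang_iff_of_singletons {A : Type*} {f : A} {M : Set (HTrace A)}
    (hM : ∀ xs ∈ M, ∃ x, xs = [x]) {t : HTrace A} :
    NamedLang f M t ↔ ∃ x t', [x] ∈ M ∧ Psi f M x t' ∧ t = hcat (HSym.act f) t' := by
  constructor
  · rintro ⟨xs, ts, hxs, hlen, h⟩
    obtain ⟨x, rfl⟩ := hM xs hxs
    obtain ⟨t', rfl⟩ := List.length_eq_one_iff.1 hlen
    exact ⟨x, t', hxs, h 0, by simp⟩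
  · rintro ⟨x, t', hx, h, rfl⟩
    exact .of_singleton hx h

/-- Every trace of `▽ˡ_f({⟨g a⟩, ⟨g △_f⟩})` is `⟨(f g)ⁿ a⟩` for some `n ≥ 1`. -/
theorem NamedLang.exists_replicate {A : Type*} {f g a : A} {t : HTrace A}
    (ht : NamedLang f {[[HSym.act g, HSym.act a]], [[HSym.act g, HSym.mark f]]} t) :
    ∃ n : ℕ, 1 ≤ n ∧
      t = [(List.replicate n [HSym.act f, HSym.act g]).flatten ++ [HSym.act a]] := by
  refine NamedLang.rec
    (motive_1 := fun t _ => ∃ n : ℕ, 1 ≤ n ∧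
      t = [(List.replicate n [HSym.act f, HSym.act g]).flatten ++ [HSym.act a]])
    (motive_2 := fun x t _ =>
      (x = [HSym.mark f] → ∃ n : ℕ, 1 ≤ n ∧
        t = [(List.replicate n [HSym.act f, HSym.act g]).flatten ++ [HSym.act a]]) ∧
      (x = [HSym.act g, HSym.mark f] → ∃ n : ℕ, 1 ≤ n ∧
        t = [HSym.act g ::
          ((List.replicate n [HSym.act f, HSym.act g]).flatten ++ [HSym.act a])]))
    ?_ ?_ ?_ ?_ ?_ ht
  · rintro xs ts (rfl | rfl) hlen hpsi ih
    all_goals obtain ⟨t', rfl⟩ := List.length_eq_one_iff.1 hlen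
    · obtain ⟨t₁, h₁, h⟩ := psi_act_cons_iff.1 (hpsi 0)
      obtain ⟨t₂, h₂, rfl⟩ := psi_act_cons_iff.1 h₁
      obtain rfl := psi_nil_iff.1 h₂
      obtain rfl : t' = _ := h
      exact ⟨1, le_rfl, by simp [hcat]⟩
    · obtain ⟨n, -, h⟩ := (ih 0).2 rfl
      obtain rfl : t' = _ := h
      exact ⟨n + 1, by omega, by simp [hcat, List.replicate_succ]⟩
  · simp
  · rintro t - ih
    exact ⟨fun _ => ih, by simp⟩
  · rintro g' hg'
    exact ⟨fun h => absurd (by simpa using h) hg', by simp⟩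
  · rintro b x t - ih
    refine ⟨by simp, fun h => ?_⟩
    simp only [List.cons.injEq, HSym.act.injEq] at h
    obtain ⟨rfl, hx⟩ := h
    obtain ⟨n, hn, rfl⟩ := ih.1 hx
    exact ⟨n, hn, by simp [hcat]⟩

/-- `▽ˡ_f({⟨g a⟩, ⟨g △_f⟩})` consists of the traces `⟨(f g)ⁿ a⟩` with `n ≥ 1`. -/
theorem namedLang_tail_recursive_iff {A : Type*} (f g a : A) {t : HTrace A} :
    NamedLang f {[[HSym.act g, HSym.act a]], [[HSym.act g, HSym.mark f]]} t ↔
      ∃ n : ℕ, 1 ≤ n ∧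
        t = [(List.replicate n [HSym.act f, HSym.act g]).flatten ++ [HSym.act a]] := by
  refine ⟨NamedLang.exists_replicate, ?_⟩
  rintro ⟨n, hn, rfl⟩
  induction n, hn using Nat.le_induction with
  | base =>
    exact .of_singleton (x := [HSym.act g, HSym.act a]) (by simp) (Psi.act (Psi.act Psi.nil))
  | succ n _ ih =>
    have := NamedLang.of_singleton (x := [HSym.act g, HSym.mark f]) (by simp)
      (Psi.act (Psi.recSame ih))
    simpa [hcat, List.replicate_succ] using this

/-- recursive language characterization (mutual nesting):
`L(▽_f(▽_g(×(a, △_f))))` consists exactly of the single-event traces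
`⟨(f g)ⁿ · a⟩` for `n ≥ 1`. -/
theorem mutual_nesting_lang {A : Type*} (a f g : A)
    (haf : a ≠ f) (hag : a ≠ g) (hfg : f ≠ g) :
    hlang (HTree.named f (HTree.named g (HTree.choice [HTree.act a, HTree.recCall f]))) =
      {t | ∃ n : ℕ, 1 ≤ n ∧
        t = [(List.replicate n [HSym.act f, HSym.act g]).flatten ++ [HSym.act a]]} := by
  have h_choice : hlang (HTree.choice [HTree.act a, HTree.recCall f]) =
      {[[HSym.act a]], [[HSym.mark f]]} := by
    ext t
    simp [hlang, choiceJoin]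
  have h_inner : hlang (HTree.named g (HTree.choice [HTree.act a, HTree.recCall f])) =
      {[[HSym.act g, HSym.act a]], [[HSym.act g, HSym.mark f]]} := by
    ext t
    rw [hlang, h_choice, Set.mem_ofPred_eq, namedLang_iff_of_singletons (by simp)]
    constructor
    · rintro ⟨x, t', hx, ht', rfl⟩
      simp only [Set.mem_insert_iff, Set.mem_singleton_iff, List.cons.injEq, and_true] at hx
      rcases hx with rfl | rfl
      · obtain ⟨t'', h, rfl⟩ := psi_act_cons_iff.1 ht'
        rw [psi_nil_iff.1 h]
        simp [hcat]
      · rw [psi_mark_of_ne_iff hfg] at ht'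
        simp [ht', hcat]
    · rintro (rfl | rfl)
      · exact ⟨[HSym.act a], [[HSym.act a]], by simp, Psi.act Psi.nil, rfl⟩
      · exact ⟨[HSym.mark f], [[HSym.mark f]], by simp, Psi.recOther hfg, rfl⟩
  ext t
  rw [hlang, h_inner]
  exact namedLang_tail_recursive_iff f g a
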